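/- The abelianization Γ_1(H_3)/Γ_2(H_3) = H_3/[H_3, H_3] is isomorphic to ℤ ⊕ ℤ, and for every n ≥ 4 the abelianization Γ_1(H_n)/Γ_2(H_n) = H_n/[H_n, H_n] is isomorphic to ℤ. -/

import Mathlib

/-- The free-group letter corresponding to the braid generator `σ_{i+1}`
(0-based index `i`) of the virtual braid group on `n` strands. -/
def σg (n : ℕ) (i : Fin (n-1)) : FreeGroup (Fin (n-1) ⊕ Fin (n-1)) := FreeGroup.of (Sum.inl i)

/-- The free-group letter corresponding to the virtual generator `ρ_{i+1}`
(0-based index `i`) of the virtual braid group on `n` strands. -/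
def ρg (n : ℕ) (i : Fin (n-1)) : FreeGroup (Fin (n-1) ⊕ Fin (n-1)) := FreeGroup.of (Sum.inr i)

/-- The defining relators of the virtual braid group `VB n`. -/
def vbRels (n : ℕ) : Set (FreeGroup (Fin (n-1) ⊕ Fin (n-1))) :=
  {r | ∃ i j : Fin (n-1),
    ((i:ℕ)+1 = (j:ℕ) ∧ r = σg n i * σg n j * σg n i * (σg n j * σg n i * σg n j)⁻¹) ∨
    (((i:ℕ)+2 ≤ (j:ℕ) ∨ (j:ℕ)+2 ≤ (i:ℕ)) ∧ r = σg n i * σg n j * (σg n j * σg n i)⁻¹) ∨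
    ((i:ℕ)+1 = (j:ℕ) ∧ r = ρg n i * ρg n j * ρg n i * (ρg n j * ρg n i * ρg n j)⁻¹) ∨
    (((i:ℕ)+2 ≤ (j:ℕ) ∨ (j:ℕ)+2 ≤ (i:ℕ)) ∧ r = ρg n i * ρg n j * (ρg n j * ρg n i)⁻¹) ∨
    (r = ρg n i * ρg n i) ∨
    (((i:ℕ)+2 ≤ (j:ℕ) ∨ (j:ℕ)+2 ≤ (i:ℕ)) ∧ r = σg n i * ρg n j * (ρg n j * σg n i)⁻¹) ∨
    ((i:ℕ)+1 = (j:ℕ) ∧ r = ρg n i * ρg n j * σg n i * (σg n j * ρg n i * ρg n j)⁻¹)}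

/-- The virtual braid group on `n` strands, given by its standard presentation. -/
abbrev VB (n : ℕ) : Type := PresentedGroup (vbRels n)

/-- The generator `σ_{i+1}` of `VB n`. -/
def σv (n : ℕ) (i : Fin (n-1)) : VB n := PresentedGroup.of (Sum.inl i)

/-- The generator `ρ_{i+1}` of `VB n`. -/
def ρv (n : ℕ) (i : Fin (n-1)) : VB n := PresentedGroup.of (Sum.inr i)

/-- The transposition `(i+1, i+2)` (0-based: swapping `i` and `i+1`) in `S_n`. -/
def sw (n : ℕ) (i : Fin (n-1)) : Equiv.Perm (Fin n) :=
  Equiv.swap ⟨i.val, by have := i.isLt; omega⟩ ⟨i.val + 1, by have := i.isLt; omega⟩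

/-- `μ : VB n → S_n` sends each `σ_i` to `1` and each `ρ_i` to the transposition `(i, i+1)`.
Its kernel is the normal closure `H_n` of the braid group `B_n` in `VB n`. -/
def IsMu (n : ℕ) (μ : VB n →* Equiv.Perm (Fin n)) : Prop :=
  ∀ i : Fin (n-1), μ (σv n i) = 1 ∧ μ (ρv n i) = sw n i

/-- `ν : VB n → S_n` sends both `σ_i` and `ρ_i` to the transposition `(i, i+1)`.
Its kernel is the virtual pure braid group `VP_n`. -/
def IsNu (n : ℕ) (ν : VB n →* Equiv.Perm (Fin n)) : Prop :=
  ∀ i : Fin (n-1), ν (σv n i) = sw n i ∧ ν (ρv n i) = sw n i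

/-- The descending product `s (k + l - 1) * ⋯ * s (k + 1) * s k`. -/
def descProd {G : Type*} [Group G] (s : ℕ → G) : ℕ → ℕ → G
  | _, 0 => 1
  | k, l + 1 => descProd s (k + 1) l * s k

section Coxeter

variable {G : Type*} [Group G] {s : ℕ → G}

theorem descProd_succ_left (k l : ℕ) : descProd s k (l + 1) = s (k + l) * descProd s k l := by
  induction l generalizing k with
  | zero => simp [descProd]
  | succ l ih =>
    rw [descProd, ih (k + 1), descProd, mul_assoc, show k + 1 + l = k + (l + 1) by omega]

theorem descProd_mul_of_lt (hcomm : ∀ i j, i + 2 ≤ j → s i * s j = s j * s i)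
    {j k : ℕ} (l : ℕ) (h : j + 1 < k) : descProd s k l * s j = s j * descProd s k l := by
  induction l generalizing k with
  | zero => simp [descProd]
  | succ l ih =>
    rw [descProd, mul_assoc, ← hcomm j k h, ← mul_assoc, ih (by omega), mul_assoc]

theorem descProd_mul_of_gt {N : ℕ} (hcomm : ∀ i j, i + 2 ≤ j → s i * s j = s j * s i)
    (hbraid : ∀ i, i + 1 < N → s i * s (i + 1) * s i = s (i + 1) * s i * s (i + 1))
    {k t l : ℕ} (htl : t + 1 < l) (hN : k + l ≤ N) :
    descProd s k l * s (k + 1 + t) = s (k + t) * descProd s k l := by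
  induction l generalizing k t with
  | zero => omega
  | succ l ih =>
    rcases t with _ | t
    · obtain ⟨l, rfl⟩ : ∃ m, l = m + 1 := ⟨l - 1, by omega⟩
      simp only [descProd, Nat.add_zero]
      rw [mul_assoc, mul_assoc, ← mul_assoc (s (k + 1)), ← hbraid k (by omega), ← mul_assoc,
        ← mul_assoc, descProd_mul_of_lt hcomm l (by omega)]
      simp only [mul_assoc]
    · rw [descProd, mul_assoc, hcomm k (k + 1 + (t + 1)) (by omega), ← mul_assoc,
        show k + 1 + (t + 1) = (k + 1) + 1 + t by omega, ih (by omega) (by omega),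
        show k + 1 + t = k + (t + 1) by omega, mul_assoc]

/-- Coset decomposition of the subgroup generated by the first `m + 1` Coxeter generators of type
`A` with respect to the subgroup generated by the first `m`. -/
theorem exists_eq_mul_descProd {N : ℕ} (hsq : ∀ i, s i * s i = 1)
    (hcomm : ∀ i j, i + 2 ≤ j → s i * s j = s j * s i)
    (hbraid : ∀ i, i + 1 < N → s i * s (i + 1) * s i = s (i + 1) * s i * s (i + 1))
    {m : ℕ} (hm : m < N) {g : G} (hg : g ∈ Subgroup.closure (s '' Set.Iio (m + 1))) :
    ∃ p ∈ Subgroup.closure (s '' Set.Iio m), ∃ k l, k + l = m + 1 ∧ g = p * descProd s k l := by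
  have hmem : ∀ {i}, i < m → s i ∈ Subgroup.closure (s '' Set.Iio m) := fun {i} hi =>
    Subgroup.subset_closure ⟨i, hi, rfl⟩
  have step : ∀ x j, j < m + 1 →
      (∃ p ∈ Subgroup.closure (s '' Set.Iio m), ∃ k l, k + l = m + 1 ∧ x = p * descProd s k l) →
      ∃ p ∈ Subgroup.closure (s '' Set.Iio m), ∃ k l, k + l = m + 1 ∧
        x * s j = p * descProd s k l := by
    rintro _ j hj ⟨p, hp, k, l, hkl, rfl⟩
    rcases lt_trichotomy (j + 1) k with h | h | h
    · exact ⟨p * s j, mul_mem hp (hmem (by omega)), k, l, hkl, by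
        rw [mul_assoc, descProd_mul_of_lt hcomm l h, mul_assoc]⟩
    · subst h
      exact ⟨p, hp, j, l + 1, by omega, by rw [descProd, mul_assoc]⟩
    · obtain ⟨l, rfl⟩ : ∃ r, l = r + 1 := ⟨l - 1, by omega⟩
      rcases eq_or_lt_of_le (show k ≤ j by omega) with rfl | h'
      · exact ⟨p, hp, k + 1, l, by omega, by
          rw [descProd, mul_assoc, mul_assoc, hsq, mul_one]⟩
      · obtain ⟨t, rfl⟩ : ∃ t, j = k + 1 + t := ⟨j - (k + 1), by omega⟩
        exact ⟨p * s (k + t), mul_mem hp (hmem (by omega)), k, l + 1, hkl, by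
          rw [mul_assoc, descProd_mul_of_gt hcomm hbraid (by omega) (by omega), mul_assoc]⟩
  induction hg using Subgroup.closure_induction_right with
  | one => exact ⟨1, one_mem _, m + 1, 0, by omega, by simp [descProd]⟩
  | mul_right x _ y hy ih =>
    obtain ⟨j, hj, rfl⟩ := hy
    exact step x j hj ih
  | mul_inv_cancel x _ y hy ih =>
    obtain ⟨j, hj, rfl⟩ := hy
    rw [inv_eq_of_mul_eq_one_left (hsq j)]
    exact step x j hj ih

/-- A homomorphism to the symmetric group sending elements that satisfy the Coxeter relations of
type `A` to the simple transpositions is injective on the subgroup they generate. -/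
theorem eq_one_of_mem_closure_of_map_eq_one {n : ℕ} (hsq : ∀ i, s i * s i = 1)
    (hcomm : ∀ i j, i + 2 ≤ j → s i * s j = s j * s i)
    (hbraid : ∀ i, i + 1 < n - 1 → s i * s (i + 1) * s i = s (i + 1) * s i * s (i + 1))
    (f : G →* Equiv.Perm (Fin n))
    (hf : ∀ i (h : i + 1 < n), f (s i) = Equiv.swap ⟨i, by omega⟩ ⟨i + 1, h⟩)
    {m : ℕ} (hm : m ≤ n - 1) {g : G} (hg : g ∈ Subgroup.closure (s '' Set.Iio m))
    (h1 : f g = 1) : g = 1 := by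
  have hfix : ∀ m, m ≤ n - 1 → ∀ p ∈ Subgroup.closure (s '' Set.Iio m), ∀ x : Fin n,
      m < x.val → f p x = x := by
    intro m hm p hp x hx
    induction hp using Subgroup.closure_induction with
    | mem y hy =>
      obtain ⟨i, hi, rfl⟩ := hy
      have hi : i < m := hi
      rw [hf i (by omega)]
      exact Equiv.swap_apply_of_ne_of_ne (fun h => by simp [h] at hx; omega)
        (fun h => by simp [h] at hx; omega)
    | one => simp
    | mul a b _ _ ha hb => rw [map_mul, Equiv.Perm.mul_apply, hb, ha]
    | inv a _ ha => rw [map_inv, Equiv.Perm.inv_eq_iff_eq, ha]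
  have hdesc : ∀ l k (h : k + l < n), f (descProd s k l) ⟨k, by omega⟩ = ⟨k + l, h⟩ := by
    intro l
    induction l with
    | zero => intro k h; simp [descProd]
    | succ l ih =>
      intro k h
      rw [descProd_succ_left, map_mul, Equiv.Perm.mul_apply, ih k (by omega),
        hf (k + l) (by omega), Equiv.swap_apply_left]
      rfl
  induction m generalizing g with
  | zero => simpa using hg
  | succ m ih =>
    obtain ⟨p, hp, k, l, hkl, rfl⟩ := exists_eq_mul_descProd hsq hcomm hbraid (by omega) hg
    have hk := congrArg (fun e : Equiv.Perm (Fin n) => e ⟨k, by omega⟩) h1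
    simp only [map_mul, Equiv.Perm.mul_apply, Equiv.Perm.one_apply] at hk
    rw [hdesc l k (by omega), hfix m (by omega) p hp _ (by simp; omega)] at hk
    obtain rfl : l = 0 := by simpa using hk
    simp only [descProd, mul_one] at h1 ⊢
    exact ih (by omega) hp h1 hdesc

end Coxeter

section Relations

variable {n : ℕ} {i j : Fin (n - 1)}

theorem σv_braid (h : (i : ℕ) + 1 = j) :
    σv n i * σv n j * σv n i = σv n j * σv n i * σv n j := by
  have := PresentedGroup.one_of_mem (rels := vbRels n) ⟨i, j, Or.inl ⟨h, rfl⟩⟩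
  exact mul_inv_eq_one.1 this

theorem ρv_braid (h : (i : ℕ) + 1 = j) :
    ρv n i * ρv n j * ρv n i = ρv n j * ρv n i * ρv n j := by
  have := PresentedGroup.one_of_mem (rels := vbRels n) ⟨i, j, .inr (.inr (.inl ⟨h, rfl⟩))⟩
  exact mul_inv_eq_one.1 this

theorem ρv_comm (h : (i : ℕ) + 2 ≤ j ∨ (j : ℕ) + 2 ≤ i) :
    ρv n i * ρv n j = ρv n j * ρv n i := by
  have := PresentedGroup.one_of_mem (rels := vbRels n) ⟨i, j, .inr (.inr (.inr (.inl ⟨h, rfl⟩)))⟩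
  exact mul_inv_eq_one.1 this

theorem ρv_mul_self (i : Fin (n - 1)) : ρv n i * ρv n i = 1 :=
  PresentedGroup.one_of_mem (rels := vbRels n) ⟨i, i, .inr (.inr (.inr (.inr (.inl rfl))))⟩

theorem σv_ρv_comm (h : (i : ℕ) + 2 ≤ j ∨ (j : ℕ) + 2 ≤ i) :
    σv n i * ρv n j = ρv n j * σv n i := by
  have := PresentedGroup.one_of_mem (rels := vbRels n)
    ⟨i, j, .inr (.inr (.inr (.inr (.inr (.inl ⟨h, rfl⟩)))))⟩
  exact mul_inv_eq_one.1 this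

theorem ρv_ρv_σv (h : (i : ℕ) + 1 = j) :
    ρv n i * ρv n j * σv n i = σv n j * ρv n i * ρv n j := by
  have := PresentedGroup.one_of_mem (rels := vbRels n)
    ⟨i, j, .inr (.inr (.inr (.inr (.inr (.inr ⟨h, rfl⟩)))))⟩
  exact mul_inv_eq_one.1 this

/-- A homomorphism out of `VB n` that is constant on the two kinds of generators. -/
theorem VB.exists_hom {G : Type*} [Group G] {x y : G} (hy : y * y = 1)
    (hxy : 4 ≤ n → x * y = y * x) :
    ∃ F : VB n →* G, ∀ i, F (σv n i) = x ∧ F (ρv n i) = y := by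
  have h : ∀ r ∈ vbRels n, FreeGroup.lift (Sum.elim (fun _ => x) (fun _ => y)) r = 1 := by
    rintro r ⟨i, j, ⟨_, rfl⟩ | ⟨_, rfl⟩ | ⟨_, rfl⟩ | ⟨_, rfl⟩ | rfl | ⟨hij, rfl⟩ | ⟨_, rfl⟩⟩
    all_goals simp only [σg, ρg, map_mul, map_inv, FreeGroup.lift_apply_of, Sum.elim_inl,
      Sum.elim_inr, mul_inv_cancel, hy]
    · rw [hxy (by omega), mul_inv_cancel]
    · rw [mul_assoc x, hy, one_mul, mul_one, mul_inv_cancel]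
  exact ⟨PresentedGroup.toGroup h, fun i =>
    ⟨PresentedGroup.toGroup.of h, PresentedGroup.toGroup.of h⟩⟩

/-- Induction on elements of `VB n` by right multiplication by generators. -/
theorem VB.induction_right {p : VB n → Prop} (one : p 1)
    (mul_σ : ∀ g i, p (g * σv n i) ↔ p g) (mul_ρ : ∀ g i, p g → p (g * ρv n i)) (g : VB n) :
    p g := by
  have hg : g ∈ Subgroup.closure (Set.range (PresentedGroup.of (rels := vbRels n))) := by
    rw [PresentedGroup.closure_range_of]; trivial
  induction hg using Subgroup.closure_induction_right with
  | one => exact one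
  | mul_right x _ y hy ih =>
    obtain ⟨i | i, rfl⟩ := hy
    · exact (mul_σ x i).2 ih
    · exact mul_ρ x i ih
  | mul_inv_cancel x _ y hy ih =>
    obtain ⟨i | i, rfl⟩ := hy
    · rw [← mul_σ _ i]
      simpa [σv] using ih
    · have : (PresentedGroup.of (Sum.inr i) : VB n)⁻¹ = ρv n i :=
        inv_eq_of_mul_eq_one_left (ρv_mul_self i)
      rw [this]
      exact mul_ρ x i ih

end Relations

section Kernel

variable {n : ℕ} {μ : VB n →* Equiv.Perm (Fin n)}

/-- The kernel of `μ` is contained in the normal closure of the braid generators. -/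
theorem IsMu.ker_le (hμ : IsMu n μ) : μ.ker ≤ Subgroup.normalClosure (Set.range (σv n)) := by
  set s : ℕ → VB n := fun i => if h : i < n - 1 then ρv n ⟨i, h⟩ else 1 with hs
  set P := Subgroup.closure (s '' Set.Iio (n - 1)) with hP
  have hsP : ∀ i, ρv n i ∈ P := fun i =>
    Subgroup.subset_closure ⟨i, i.isLt, by simp [hs]⟩
  have hN : Subgroup.normalClosure (Set.range (σv n)) ≤ μ.ker := by
    refine Subgroup.normalClosure_le_normal ?_
    rintro _ ⟨i, rfl⟩
    exact (hμ i).1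
  have hdec : ∀ g : VB n, ∃ x ∈ Subgroup.normalClosure (Set.range (σv n)), ∃ p ∈ P, x * p = g := by
    intro g
    rw [← Subgroup.mem_sup_of_normal_left]
    have hσ : ∀ i, σv n i ∈ Subgroup.normalClosure (Set.range (σv n)) ⊔ P := fun i =>
      Subgroup.mem_sup_left (Subgroup.subset_normalClosure ⟨i, rfl⟩)
    induction g using VB.induction_right with
    | one => exact one_mem _
    | mul_σ g i => exact Subgroup.mul_mem_cancel_right _ (hσ i)
    | mul_ρ g i hg => exact mul_mem hg (Subgroup.mem_sup_right (hsP i))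
  intro g hg
  obtain ⟨x, hx, p, hp, rfl⟩ := hdec g
  have hp1 : μ p = 1 := by
    have := hN hx
    rw [MonoidHom.mem_ker] at this hg
    simpa [this] using hg
  suffices p = 1 by simpa [this] using hx
  refine eq_one_of_mem_closure_of_map_eq_one (n := n) ?_ ?_ ?_ μ ?_ le_rfl hp hp1
  · intro i
    simp only [hs]
    split_ifs with h
    · exact ρv_mul_self _
    · simp
  · intro i j hij
    simp only [hs]
    split_ifs
    · exact ρv_comm (Or.inl hij)
    all_goals simp
  · intro i hi
    simp only [hs, hi, show i < n - 1 by omega, dif_pos]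
    exact ρv_braid rfl
  · intro i hi
    simp only [hs, show i < n - 1 by omega, dif_pos]
    exact (hμ _).2

theorem IsMu.conj_mem (hμ : IsMu n μ) (g : VB n) (i : Fin (n - 1)) :
    g * σv n i * g⁻¹ ∈ μ.ker := by
  simp [MonoidHom.mem_ker, (hμ i).1]

/-- The class of `g σ_i g⁻¹` in the abelianization of the kernel of `μ`. -/
def conjClass (hμ : IsMu n μ) (g : VB n) (i : Fin (n - 1)) : Abelianization μ.ker :=
  Abelianization.of ⟨g * σv n i * g⁻¹, hμ.conj_mem g i⟩

variable (hμ : IsMu n μ)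

theorem conjClass_mem_eq_top (L : Subgroup (Abelianization μ.ker))
    (hL : ∀ g i, conjClass hμ g i ∈ L) : L = ⊤ := by
  have key : ∀ x ∈ Subgroup.normalClosure (Set.range (σv n)),
      ∃ hx : x ∈ μ.ker, Abelianization.of (⟨x, hx⟩ : μ.ker) ∈ L := by
    intro x hx
    induction hx using Subgroup.closure_induction with
    | mem y hy =>
      obtain ⟨_, ⟨i, rfl⟩, c⟩ := Group.mem_conjugatesOfSet_iff.1 hy
      obtain ⟨g, rfl⟩ := isConj_iff.1 c
      exact ⟨hμ.conj_mem g i, hL g i⟩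
    | one => exact ⟨one_mem _, one_mem L⟩
    | mul a b _ _ ha hb =>
      obtain ⟨ha, ha'⟩ := ha
      obtain ⟨hb, hb'⟩ := hb
      exact ⟨mul_mem ha hb, mul_mem ha' hb'⟩
    | inv a _ ha =>
      obtain ⟨ha, ha'⟩ := ha
      exact ⟨inv_mem ha, inv_mem ha'⟩
  rw [eq_top_iff]
  intro x _
  obtain ⟨⟨h, hh⟩, rfl⟩ := QuotientGroup.mk_surjective x
  exact (key h (hμ.ker_le hh)).2

theorem conjClass_congr {g g' : VB n} {i j : Fin (n - 1)}
    (h : g * σv n i * g⁻¹ = g' * σv n j * g'⁻¹) : conjClass hμ g i = conjClass hμ g' j := by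
  simp only [conjClass, h]

theorem conjClass_mul_left {h : VB n} (hh : h ∈ μ.ker) (g : VB n) (i : Fin (n - 1)) :
    conjClass hμ (h * g) i = conjClass hμ g i := by
  have : (⟨h * g * σv n i * (h * g)⁻¹, hμ.conj_mem _ i⟩ : μ.ker) =
      ⟨h, hh⟩ * ⟨g * σv n i * g⁻¹, hμ.conj_mem g i⟩ * ⟨h, hh⟩⁻¹ := by
    ext
    simp [mul_assoc]
  simp only [conjClass, this, map_mul, map_inv, mul_inv_cancel_comm]

theorem conjClass_mul_σv_mul (g g' : VB n) (i j : Fin (n - 1)) :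
    conjClass hμ (g * σv n j * g') i = conjClass hμ (g * g') i := by
  rw [← conjClass_mul_left hμ (hμ.conj_mem g j) (g * g')]
  simp [mul_assoc]

theorem conjClass_mul_σv (g : VB n) (i j : Fin (n - 1)) :
    conjClass hμ (g * σv n j) i = conjClass hμ g i := by
  simpa using conjClass_mul_σv_mul hμ g 1 i j

theorem conjClass_succ (g : VB n) {i j : Fin (n - 1)} (h : (i : ℕ) + 1 = j) :
    conjClass hμ g i = conjClass hμ g j := by
  have : (⟨g * σv n i * g⁻¹, hμ.conj_mem g i⟩ * ⟨g * σv n j * g⁻¹, hμ.conj_mem g j⟩ *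
      ⟨g * σv n i * g⁻¹, hμ.conj_mem g i⟩ : μ.ker) =
      ⟨g * σv n j * g⁻¹, hμ.conj_mem g j⟩ * ⟨g * σv n i * g⁻¹, hμ.conj_mem g i⟩ *
      ⟨g * σv n j * g⁻¹, hμ.conj_mem g j⟩ := by
    ext
    have := congrArg (fun x => g * x * g⁻¹) (σv_braid h)
    simpa [mul_assoc] using this
  have := congrArg Abelianization.of this
  simp only [map_mul] at this
  rw [mul_comm (Abelianization.of (⟨g * σv n j * g⁻¹, hμ.conj_mem g j⟩ : μ.ker))] at this
  exact mul_left_cancel this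

theorem conjClass_eq (g : VB n) (i j : Fin (n - 1)) : conjClass hμ g i = conjClass hμ g j := by
  have h0 : ∀ k (hk : k < n - 1), conjClass hμ g ⟨k, hk⟩ = conjClass hμ g ⟨0, by omega⟩ := by
    intro k
    induction k with
    | zero => intro _; rfl
    | succ k ih =>
      intro hk
      rw [← ih (by omega)]
      exact (conjClass_succ hμ g rfl).symm
  exact (h0 i i.isLt).trans (h0 j j.isLt).symm

theorem conjClass_mul_ρv_of_far (g : VB n) {i j : Fin (n - 1)}
    (h : (i : ℕ) + 2 ≤ j ∨ (j : ℕ) + 2 ≤ i) (k : Fin (n - 1)) :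
    conjClass hμ (g * ρv n j) k = conjClass hμ g k := by
  rw [conjClass_eq hμ _ k i, conjClass_eq hμ _ k i]
  apply conjClass_congr
  rw [mul_assoc g, ← σv_ρv_comm h]
  simp [mul_assoc]

theorem conjClass_mul_ρv_mul_ρv (g : VB n) {i j : Fin (n - 1)} (h : (i : ℕ) + 1 = j)
    (k : Fin (n - 1)) : conjClass hμ (g * ρv n i * ρv n j) k = conjClass hμ g k := by
  rw [conjClass_eq hμ _ k i, conjClass_eq hμ g k j]
  apply conjClass_congr
  rw [mul_assoc g, mul_assoc g, ρv_ρv_σv h]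
  simp [mul_assoc]

theorem conjClass_mul_ρv_succ (g : VB n) {i j : Fin (n - 1)} (h : (i : ℕ) + 1 = j)
    (k : Fin (n - 1)) : conjClass hμ (g * ρv n j) k = conjClass hμ (g * ρv n i) k := by
  rw [← conjClass_mul_ρv_mul_ρv hμ (g * ρv n i) h, mul_assoc g, ρv_mul_self, mul_one]

theorem conjClass_mul_ρv_eq (g : VB n) (i j k : Fin (n - 1)) :
    conjClass hμ (g * ρv n i) k = conjClass hμ (g * ρv n j) k := by
  have h0 : ∀ m (hm : m < n - 1), conjClass hμ (g * ρv n ⟨m, hm⟩) k =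
      conjClass hμ (g * ρv n ⟨0, by omega⟩) k := by
    intro m
    induction m with
    | zero => intro _; rfl
    | succ m ih =>
      intro hm
      rw [← ih (by omega)]
      exact conjClass_mul_ρv_succ hμ g rfl k
  exact (h0 i i.isLt).trans (h0 j j.isLt).symm

theorem conjClass_eq_one_of_four_le (hn : 4 ≤ n) (g : VB n) (i : Fin (n - 1)) :
    conjClass hμ g i = conjClass hμ 1 i := by
  induction g using VB.induction_right with
  | one => rfl
  | mul_σ g j => rw [conjClass_mul_σv]
  | mul_ρ g j hg =>
    rw [conjClass_mul_ρv_eq hμ g j ⟨2, by omega⟩, ← hg]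
    exact conjClass_mul_ρv_of_far hμ g (i := ⟨0, by omega⟩) (Or.inl le_rfl) i

theorem conjClass_eq_or (hn : 3 ≤ n) (g : VB n) (i j : Fin (n - 1)) :
    (conjClass hμ g i = conjClass hμ 1 i ∧
      conjClass hμ (g * ρv n j) i = conjClass hμ (ρv n j) i) ∨
    (conjClass hμ g i = conjClass hμ (ρv n j) i ∧
      conjClass hμ (g * ρv n j) i = conjClass hμ 1 i) := by
  have hinv : ∀ (g : VB n) (m : Fin (n - 1)),
      conjClass hμ (g * ρv n m * ρv n j) i = conjClass hμ g i := by
    intro g m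
    rw [mul_assoc, ← conjClass_mul_ρv_mul_ρv hμ g (i := ⟨0, by omega⟩) (j := ⟨1, by omega⟩) rfl,
      ← mul_assoc, conjClass_mul_ρv_eq hμ (g * ρv n m) j m, mul_assoc, ρv_mul_self, mul_one,
      conjClass_mul_ρv_mul_ρv hμ g rfl]
  induction g using VB.induction_right with
  | one => simp
  | mul_σ g m =>
    rw [conjClass_mul_σv, conjClass_mul_σv_mul]
  | mul_ρ g m hg =>
    rw [hinv, conjClass_mul_ρv_eq hμ g m j]
    tauto

/-- The abelianization of the kernel of `μ` is infinite cyclic for `n ≥ 4`. -/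
theorem nonempty_abelianization_ker_mulEquiv_int {μ : VB n →* Equiv.Perm (Fin n)}
    (hμ : IsMu n μ) (hn : 4 ≤ n) :
    Nonempty (Abelianization μ.ker ≃* Multiplicative ℤ) := by
  let i₀ : Fin (n - 1) := ⟨0, by omega⟩
  obtain ⟨F, hF⟩ := VB.exists_hom (n := n) (x := Multiplicative.ofAdd (1 : ℤ)) (y := 1)
    (mul_one 1) (fun _ => mul_comm _ _)
  let φ : Abelianization μ.ker →* Multiplicative ℤ :=
    Abelianization.lift (F.comp μ.ker.subtype)
  set a := conjClass hμ 1 i₀ with ha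
  have hφ : φ a = Multiplicative.ofAdd (1 : ℤ) := by
    simp [φ, ha, conjClass, (hF _).1]
  have htop : Subgroup.zpowers a = ⊤ := by
    apply conjClass_mem_eq_top hμ
    intro g i
    rw [conjClass_eq hμ g i i₀, conjClass_eq_one_of_four_le hμ hn]
    exact Subgroup.mem_zpowers _
  refine ⟨MulEquiv.ofBijective φ ⟨?_, fun m => ⟨a ^ m.toAdd, ?_⟩⟩⟩
  · rw [injective_iff_map_eq_one]
    intro x hx
    obtain ⟨m, rfl⟩ := Subgroup.mem_zpowers_iff.1 (htop ▸ Subgroup.mem_top x)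
    rw [map_zpow, hφ, ← ofAdd_zsmul] at hx
    have hm : m = 0 := by simpa using hx
    rw [hm, zpow_zero]
  · rw [map_zpow, hφ, ← ofAdd_zsmul]
    simp

end Kernel

/-- The exchange of the two factors of `ℤ × ℤ`, as an automorphism. -/
def swapAut : MulAut (Multiplicative (ℤ × ℤ)) :=
  AddEquiv.toMultiplicative (AddEquiv.prodComm : ℤ × ℤ ≃+ ℤ × ℤ)

/-- The abelianization of the kernel of `μ` is free abelian of rank two for `n = 3`. -/
theorem nonempty_abelianization_ker_mulEquiv_int_prod {μ : VB 3 →* Equiv.Perm (Fin 3)}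
    (hμ : IsMu 3 μ) : Nonempty (Abelianization μ.ker ≃* Multiplicative (ℤ × ℤ)) := by
  let i₀ : Fin (3 - 1) := ⟨0, by omega⟩
  let e : Multiplicative (ℤ × ℤ) := Multiplicative.ofAdd (1, 0)
  have hswap : swapAut * swapAut = 1 := by ext x <;> rfl
  obtain ⟨F, hF⟩ := VB.exists_hom (n := 3)
    (x := (SemidirectProduct.inl e :
      Multiplicative (ℤ × ℤ) ⋊[MonoidHom.id _] MulAut (Multiplicative (ℤ × ℤ))))
    (y := SemidirectProduct.inr swapAut)
    (by rw [← map_mul, hswap, map_one]) (by omega)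
  have hright : ∀ x : μ.ker, (F x).right = 1 := by
    have hle : μ.ker ≤ (SemidirectProduct.rightHom.comp F).ker := by
      refine hμ.ker_le.trans (Subgroup.normalClosure_le_normal ?_)
      rintro _ ⟨i, rfl⟩
      simp [MonoidHom.mem_ker, (hF i).1]
    exact fun x => hle x.2
  let φ₀ : μ.ker →* Multiplicative (ℤ × ℤ) :=
    { toFun := fun x => (F x).left
      map_one' := by simp
      map_mul' := fun x y => by simp [SemidirectProduct.mul_left, hright x] }
  let φ : Abelianization μ.ker →* Multiplicative (ℤ × ℤ) := Abelianization.lift φ₀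
  set a := conjClass hμ 1 i₀ with ha
  set b := conjClass hμ (ρv 3 i₀) i₀ with hb
  have hφa : φ a = Multiplicative.ofAdd (1, 0) := by
    simp [φ, φ₀, ha, conjClass, (hF _).1, e]
  have hφb : φ b = Multiplicative.ofAdd (0, 1) := by
    simp [φ, φ₀, hb, conjClass, (hF _).1, (hF _).2, e]
    rfl
  have htop : Subgroup.closure {a, b} = ⊤ := by
    apply conjClass_mem_eq_top hμ
    intro g i
    rw [conjClass_eq hμ g i i₀]
    rcases conjClass_eq_or hμ le_rfl g i₀ i₀ with h | h <;>
    · rw [h.1]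
      exact Subgroup.subset_closure (by simp [ha, hb])
  have hφ : ∀ m k : ℤ, φ (a ^ m * b ^ k) = Multiplicative.ofAdd (m, k) := by
    intro m k
    rw [map_mul, map_zpow, map_zpow, hφa, hφb, ← ofAdd_zsmul, ← ofAdd_zsmul, ← ofAdd_add]
    simp
  refine ⟨MulEquiv.ofBijective φ ⟨?_, fun m => ⟨a ^ m.toAdd.1 * b ^ m.toAdd.2, hφ _ _⟩⟩⟩
  rw [injective_iff_map_eq_one]
  intro x hx
  obtain ⟨m, k, rfl⟩ := Subgroup.mem_closure_pair.1 (htop ▸ Subgroup.mem_top x)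
  rw [hφ] at hx
  obtain ⟨rfl, rfl⟩ : m = 0 ∧ k = 0 := by simpa using hx
  simp

/-- The abelianization `Γ_1(H_3)/Γ_2(H_3)` of `H_3 = ker μ` is isomorphic
to `ℤ ⊕ ℤ`, and for every `n ≥ 4` the abelianization of `H_n` is isomorphic to `ℤ`. -/
theorem hn_abelianization :
    (∀ μ : VB 3 →* Equiv.Perm (Fin 3), IsMu 3 μ →
      Nonempty (Abelianization ↥μ.ker ≃* Multiplicative (ℤ × ℤ))) ∧
    (∀ n : ℕ, 4 ≤ n → ∀ μ : VB n →* Equiv.Perm (Fin n), IsMu n μ →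
      Nonempty (Abelianization ↥μ.ker ≃* Multiplicative ℤ)) := by
  exact ⟨fun _ hμ => nonempty_abelianization_ker_mulEquiv_int_prod hμ,
    fun _ hn _ hμ => nonempty_abelianization_ker_mulEquiv_int hμ hn⟩
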